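/- Let 1 < p₂ ≤ q₂ < ∞. There exists a 2×2 matrix weight W on ℝ with [W]_{A_{p₂,q₂},𝒟} = ∞ such that [W]_{A_{p₁,q₁}} < ∞ for every choice of exponents 1 < p₁ ≤ q₁ < ∞ with q₁'/p₁ = q₂'/p₂ and p₁ < p₂ (where q' := q/(q−1)). -/

import Mathlib

open MeasureTheory ENNReal
open scoped ComplexOrder

noncomputable section

/-- The power `A^a` of a matrix, defined via the continuous functional calculus
(for positive definite Hermitian matrices this diagonalizes `A` and raises the
eigenvalues to the `a`-th power). -/
def matRpow {d : ℕ} (A : Matrix (Fin d) (Fin d) ℂ) (a : ℝ) : Matrix (Fin d) (Fin d) ℂ :=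
  cfc (fun x : ℝ => x ^ a) A

/-- The spectral norm (largest singular value) of a matrix, i.e. its norm as an operator
on the Euclidean space `ℂ^d`. -/
def specNorm {d : ℕ} (A : Matrix (Fin d) (Fin d) ℂ) : ℝ :=
  ‖Matrix.toEuclideanCLM (𝕜 := ℂ) A‖

/-- Hölder conjugate exponent. -/
def conjExp (p : ℝ) : ℝ := p / (p - 1)

/-- The Lebesgue average `⨍_Q f dμ` of an `ℝ≥0∞`-valued function. -/
def lavg {α : Type*} [MeasurableSpace α] (μ : Measure α) (Q : Set α) (f : α → ℝ≥0∞) : ℝ≥0∞ :=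
  (μ Q)⁻¹ * ∫⁻ x in Q, f x ∂μ

/-- The two-exponent matrix Muckenhoupt characteristic `[W]_{A_{p,q}}`, with the supremum
taken over a family `S` of sets. -/
def matApq {α : Type*} [MeasurableSpace α] {d : ℕ} (μ : Measure α) (S : Set (Set α))
    (W : α → Matrix (Fin d) (Fin d) ℂ) (p q : ℝ) : ℝ≥0∞ :=
  ⨆ Q ∈ S, lavg μ Q fun x =>
    (lavg μ Q fun y =>
        ENNReal.ofReal (specNorm (matRpow (W x) (1 / q) * matRpow (W y) (-(1 / q))))
          ^ conjExp p) ^ (q / conjExp p)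

/-- The endpoint matrix Muckenhoupt characteristic `[W]_{A_{t,∞}}`, with the supremum
taken over a family `S` of sets. -/
def matAtInfty {α : Type*} [MeasurableSpace α] {d : ℕ} (μ : Measure α) (S : Set (Set α))
    (W : α → Matrix (Fin d) (Fin d) ℂ) (t : ℝ) : ℝ≥0∞ :=
  ⨆ Q ∈ S, essSup (fun x =>
    lavg μ Q fun y =>
      ENNReal.ofReal (specNorm (matRpow (W x) (1 / t) * matRpow (W y) (-(1 / t)))) ^ t)
    (μ.restrict Q)

/-- The scalar reverse Hölder characteristic `[w]_{RH_s}`, with the supremum taken over a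
family `S` of sets. -/
def scalRH {α : Type*} [MeasurableSpace α] (μ : Measure α) (S : Set (Set α))
    (w : α → ℝ) (s : ℝ) : ℝ≥0∞ :=
  ⨆ Q ∈ S, (lavg μ Q fun x => ENNReal.ofReal (w x) ^ s) ^ (1 / s) /
    lavg μ Q fun x => ENNReal.ofReal (w x)

/-- The scalar reverse Hölder characteristic `[w]_{RH_∞}`, with the supremum taken over a
family `S` of sets. -/
def scalRHInfty {α : Type*} [MeasurableSpace α] (μ : Measure α) (S : Set (Set α))
    (w : α → ℝ) : ℝ≥0∞ :=
  ⨆ Q ∈ S, essSup (fun x => ENNReal.ofReal (w x)) (μ.restrict Q) /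
    lavg μ Q fun x => ENNReal.ofReal (w x)

/-- The matrix reverse Hölder characteristic `[W]_{RH_{t,s}}`. -/
def matRH {α : Type*} [MeasurableSpace α] {d : ℕ} (μ : Measure α) (S : Set (Set α))
    (W : α → Matrix (Fin d) (Fin d) ℂ) (t s : ℝ) : ℝ≥0∞ :=
  ⨆ (e : EuclideanSpace ℂ (Fin d)) (_ : e ≠ 0),
    scalRH μ S (fun x => ‖Matrix.toEuclideanCLM (𝕜 := ℂ) (matRpow (W x) (1 / t)) e‖ ^ t) s

/-- The matrix reverse Hölder characteristic `[W]_{RH_{t,∞}}`. -/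
def matRHInfty {α : Type*} [MeasurableSpace α] {d : ℕ} (μ : Measure α) (S : Set (Set α))
    (W : α → Matrix (Fin d) (Fin d) ℂ) (t : ℝ) : ℝ≥0∞ :=
  ⨆ (e : EuclideanSpace ℂ (Fin d)) (_ : e ≠ 0),
    scalRHInfty μ S (fun x => ‖Matrix.toEuclideanCLM (𝕜 := ℂ) (matRpow (W x) (1 / t)) e‖ ^ t)

/-- An axis-parallel cube in `ℝ^n` with corner `c` and positive side length `h`. -/
def cube {n : ℕ} (c : Fin n → ℝ) (h : ℝ) : Set (Fin n → ℝ) :=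
  {x | ∀ i, x i ∈ Set.Ico (c i) (c i + h)}

/-- The family of all axis-parallel cubes in `ℝ^n`. -/
def cubes (n : ℕ) : Set (Set (Fin n → ℝ)) :=
  {Q | ∃ (c : Fin n → ℝ) (h : ℝ), 0 < h ∧ Q = cube c h}

/-- The family of all (left-closed right-open, nontrivial, bounded) intervals in `ℝ`,
i.e. the axis-parallel "cubes" of `ℝ^1`. -/
def intervalsR : Set (Set ℝ) := {I | ∃ a b : ℝ, a < b ∧ I = Set.Ico a b}

/-- The family of all dyadic intervals `[m·2^k, (m+1)·2^k)`, `m, k ∈ ℤ`, in `ℝ`. -/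
def dyadicsR : Set (Set ℝ) :=
  {I | ∃ m k : ℤ, I = Set.Ico ((m : ℝ) * 2 ^ k) (((m : ℝ) + 1) * 2 ^ k)}

/-- A `d×d` matrix weight: a locally integrable matrix-valued function whose values are
a.e. positive definite (Hermitian). -/
def IsMatrixWeight {α : Type*} [MeasurableSpace α] [TopologicalSpace α] {d : ℕ}
    (μ : Measure α) (W : α → Matrix (Fin d) (Fin d) ℂ) : Prop :=
  (∀ i j, LocallyIntegrable (fun x => W x i j) μ) ∧ ∀ᵐ x ∂μ, (W x).PosDef


lemma specNorm_mul_le {d : ℕ} (A B : Matrix (Fin d) (Fin d) ℂ) :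
    specNorm (A * B) ≤ specNorm A * specNorm B := by
  simp only [specNorm, map_mul]
  exact norm_mul_le _ _

lemma specNorm_add_le {d : ℕ} (A B : Matrix (Fin d) (Fin d) ℂ) :
    specNorm (A + B) ≤ specNorm A + specNorm B := by
  simp only [specNorm, map_add]
  exact norm_add_le _ _

lemma specNorm_sub_le {d : ℕ} (A B : Matrix (Fin d) (Fin d) ℂ) :
    specNorm (A - B) ≤ specNorm A + specNorm B := by
  simp only [specNorm, map_sub]
  exact norm_sub_le _ _

lemma specNorm_smul {d : ℕ} (c : ℂ) (A : Matrix (Fin d) (Fin d) ℂ) :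
    specNorm (c • A) = ‖c‖ * specNorm A := by
  simp only [specNorm, map_smul]
  exact norm_smul _ _

lemma specNorm_nonneg {d : ℕ} (A : Matrix (Fin d) (Fin d) ℂ) : 0 ≤ specNorm A :=
  norm_nonneg _

lemma specNorm_one_le {d : ℕ} : specNorm (1 : Matrix (Fin d) (Fin d) ℂ) ≤ 1 := by
  simp only [specNorm, map_one]
  exact ContinuousLinearMap.norm_id_le

lemma norm_entry_le_specNorm {d : ℕ} (A : Matrix (Fin d) (Fin d) ℂ) (i j : Fin d) :
    ‖A i j‖ ≤ specNorm A := by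
  have h := (Matrix.toEuclideanCLM (𝕜 := ℂ) A).le_opNorm (EuclideanSpace.single j 1)
  have h2 := PiLp.norm_apply_le (Matrix.toEuclideanCLM (𝕜 := ℂ) A (EuclideanSpace.single j 1)) i
  rw [Matrix.ofLp_toEuclideanCLM] at h2
  simp only [PiLp.norm_single, norm_one, mul_one] at h
  simp only [PiLp.ofLp_single, Matrix.mulVec_single_one, Matrix.col_apply] at h2
  exact h2.trans h

lemma specNorm_single_le {d : ℕ} (i j : Fin d) (c : ℂ) :
    specNorm (Matrix.single i j c) ≤ ‖c‖ := by
  refine ContinuousLinearMap.opNorm_le_bound _ (norm_nonneg _) fun x => ?_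
  have : Matrix.toEuclideanCLM (𝕜 := ℂ) (Matrix.single i j c) x
      = EuclideanSpace.single i (c * x j) := by
    ext k
    rw [Matrix.ofLp_toEuclideanCLM, Matrix.single_mulVec]
    by_cases h : k = i <;> simp [h]
  rw [this, PiLp.norm_single, norm_mul]
  gcongr
  exact PiLp.norm_apply_le x j

/-- The spectral norm of a `2 × 2` matrix is at most four times a bound for its entries. -/
lemma specNorm_le_of_entries (A : Matrix (Fin 2) (Fin 2) ℂ) {c : ℝ} (h : ∀ i j, ‖A i j‖ ≤ c) :
    specNorm A ≤ 4 * c := by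
  have hA : A = (Matrix.single (0 : Fin 2) (0 : Fin 2) (A 0 0) + Matrix.single 0 1 (A 0 1)) +
      (Matrix.single (1 : Fin 2) (0 : Fin 2) (A 1 0) + Matrix.single 1 1 (A 1 1)) := by
    ext i j
    fin_cases i <;> fin_cases j <;> simp
  have key (i j : Fin 2) : specNorm (Matrix.single i j (A i j)) ≤ c :=
    (specNorm_single_le i j _).trans (h i j)
  rw [hA]
  have h1 := (specNorm_add_le _ _).trans (add_le_add (key 0 0) (key 0 1))
  have h2 := (specNorm_add_le _ _).trans (add_le_add (key 1 0) (key 1 1))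
  linarith [(specNorm_add_le _ _).trans (add_le_add h1 h2)]

/-- The matrix with eigenvalue `l` on the range of the projection `P` and eigenvalue `1` on its
orthogonal complement. -/
def rankOnePert {d : ℕ} (l : ℝ) (P : Matrix (Fin d) (Fin d) ℂ) : Matrix (Fin d) (Fin d) ℂ :=
  1 + (l - 1) • P

lemma cfc_eq_of_isIdempotentElem {d : ℕ} {P : Matrix (Fin d) (Fin d) ℂ} (hP : IsSelfAdjoint P)
    (hP2 : IsIdempotentElem P) (f : ℝ → ℝ) : cfc f P = f 0 • 1 + (f 1 - f 0) • P := by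
  have h : Set.EqOn f (fun x => f 0 + (f 1 - f 0) * x) (spectrum ℝ P) := by
    intro x hx
    rcases hP2.spectrum_subset ℝ hx with rfl | rfl <;> simp
  rw [cfc_congr h, cfc_const_add _ _ P (by fun_prop) hP, cfc_const_mul_id _ P hP,
    Algebra.algebraMap_eq_smul_one]

lemma matRpow_rankOnePert {d : ℕ} {P : Matrix (Fin d) (Fin d) ℂ} (hP : IsSelfAdjoint P)
    (hP2 : IsIdempotentElem P) (l a : ℝ) :
    matRpow (rankOnePert l P) a = rankOnePert (l ^ a) P := by
  have h1 : rankOnePert l P = cfc (fun x : ℝ => 1 + (l - 1) * x) P := by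
    rw [cfc_eq_of_isIdempotentElem hP hP2]
    simp [rankOnePert]
  have hfin := hP2.finite_spectrum ℝ
  rw [matRpow, h1, ← cfc_comp (fun x : ℝ => x ^ a) (fun x : ℝ => 1 + (l - 1) * x) P hP
    ((hfin.image _).continuousOn _) (hfin.continuousOn _), cfc_eq_of_isIdempotentElem hP hP2]
  simp [rankOnePert]

lemma posDef_rankOnePert {d : ℕ} {P : Matrix (Fin d) (Fin d) ℂ} (hP : IsSelfAdjoint P)
    (hP2 : IsIdempotentElem P) {l : ℝ} (hl : 1 ≤ l) : (rankOnePert l P).PosDef := by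
  have h : P.PosSemidef := by
    have := Matrix.posSemidef_conjTranspose_mul_self P
    rwa [show P.conjTranspose = P from hP, show P * P = P from hP2] at this
  exact Matrix.PosDef.one.add_posSemidef (h.smul (sub_nonneg.2 hl))

lemma specNorm_rankOnePert_mul_le {d : ℕ} {P Q : Matrix (Fin d) (Fin d) ℂ}
    (hQ2 : IsIdempotentElem Q) (hP : specNorm P ≤ 4) (hQ : specNorm Q ≤ 4) {a b δ : ℝ}
    (ha : 1 ≤ a) (hb : 1 ≤ b) (h : specNorm (P - Q) ≤ δ) :
    specNorm (rankOnePert a P * rankOnePert b⁻¹ Q) ≤ 45 + 5 * (a * δ) + 16 * (a / b) := by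
  have e : rankOnePert a P * rankOnePert b⁻¹ Q =
      ((1 - P) * (1 - Q) + ((b⁻¹ : ℝ) : ℂ) • ((1 - P) * Q)) +
      ((a : ℂ) • ((P - Q) * (1 - Q)) + ((a / b : ℝ) : ℂ) • (P * Q)) := by
    have hQQ : Q * Q = Q := hQ2
    simp only [rankOnePert, Complex.coe_smul]
    simp only [mul_add, add_mul, mul_sub, sub_mul, hQQ, mul_one, one_mul, smul_mul_assoc,
      mul_smul_comm, div_eq_mul_inv]
    module
  have n1 : specNorm (1 - P) ≤ 5 := by
    linarith [specNorm_sub_le 1 P, specNorm_one_le (d := d)]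
  have n2 : specNorm (1 - Q) ≤ 5 := by
    linarith [specNorm_sub_le 1 Q, specNorm_one_le (d := d)]
  have pr {A B : Matrix (Fin d) (Fin d) ℂ} {s t : ℝ} (hA : specNorm A ≤ s) (hB : specNorm B ≤ t) :
      specNorm (A * B) ≤ s * t :=
    (specNorm_mul_le A B).trans
      (mul_le_mul hA hB (specNorm_nonneg _) ((specNorm_nonneg _).trans hA))
  have b1 : 0 ≤ b⁻¹ := by positivity
  have b2 : b⁻¹ ≤ 1 := inv_le_one_of_one_le₀ hb
  have sm {c s : ℝ} {A : Matrix (Fin d) (Fin d) ℂ} (hc : 0 ≤ c) (hA : specNorm A ≤ s) :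
      specNorm ((c : ℂ) • A) ≤ c * s := by
    rw [specNorm_smul, Complex.norm_of_nonneg hc]
    gcongr
  rw [e]
  refine (specNorm_add_le _ _).trans ?_
  have t1 := specNorm_add_le ((1 - P) * (1 - Q)) (((b⁻¹ : ℝ) : ℂ) • ((1 - P) * Q))
  have t2 := specNorm_add_le ((a : ℂ) • ((P - Q) * (1 - Q))) (((a / b : ℝ) : ℂ) • (P * Q))
  have u1 := pr n1 n2
  have u2 := sm b1 (pr n1 hQ)
  have u3 := sm (zero_le_one.trans ha) (pr h n2)
  have u4 := sm (show 0 ≤ a / b by positivity) (pr hP hQ)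
  linarith

/-- The orthogonal projection of `ℂ²` onto the line spanned by `(t, 1)`. -/
def lineProj (t : ℝ) : Matrix (Fin 2) (Fin 2) ℂ :=
  !![((t ^ 2 / (1 + t ^ 2) : ℝ) : ℂ), ((t / (1 + t ^ 2) : ℝ) : ℂ);
    ((t / (1 + t ^ 2) : ℝ) : ℂ), ((1 / (1 + t ^ 2) : ℝ) : ℂ)]

lemma isSelfAdjoint_lineProj (t : ℝ) : IsSelfAdjoint (lineProj t) := by
  change (lineProj t).conjTranspose = lineProj t
  ext i j
  fin_cases i <;> fin_cases j <;>
    simp only [lineProj, Matrix.conjTranspose_apply] <;> simp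

lemma isIdempotentElem_lineProj (t : ℝ) : IsIdempotentElem (lineProj t) := by
  have h : (1 + t ^ 2 : ℝ) ≠ 0 := by positivity
  change lineProj t * lineProj t = lineProj t
  ext i j
  fin_cases i <;> fin_cases j <;>
    simp only [lineProj, Matrix.mul_apply, Fin.sum_univ_two, Fin.zero_eta, Fin.mk_one,
      Matrix.of_apply, Matrix.cons_val_zero, Matrix.cons_val_one, Matrix.cons_val_fin_one,
      ← Complex.ofReal_mul, ← Complex.ofReal_add, Complex.ofReal_inj] <;>
    field_simp <;> ring

lemma norm_lineProj_apply_le (t : ℝ) (i j : Fin 2) : ‖lineProj t i j‖ ≤ 1 := by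
  have h : (0 : ℝ) < 1 + t ^ 2 := by positivity
  fin_cases i <;> fin_cases j <;>
    simp only [lineProj, Fin.zero_eta, Fin.mk_one, Matrix.of_apply, Matrix.cons_val_zero,
      Matrix.cons_val_one, Matrix.cons_val_fin_one, Complex.norm_real, Real.norm_eq_abs, abs_div,
      abs_of_pos h, div_le_one h] <;> rw [abs_le] <;>
    constructor <;> nlinarith [sq_nonneg (t - 1), sq_nonneg (t + 1)]

lemma specNorm_lineProj_le (t : ℝ) : specNorm (lineProj t) ≤ 4 := by
  simpa using specNorm_le_of_entries _ (norm_lineProj_apply_le t)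

lemma specNorm_lineProj_sub_zero_le {t : ℝ} (ht : 0 ≤ t) :
    specNorm (lineProj t - lineProj 0) ≤ 4 * t := by
  have h : (0 : ℝ) < 1 + t ^ 2 := by positivity
  refine specNorm_le_of_entries _ fun i j => ?_
  have h1 : 1 / (1 + t ^ 2) - 1 = - (t ^ 2 / (1 + t ^ 2)) := by field_simp; ring
  have h2 : t ^ 2 / (1 + t ^ 2) ≤ t := by
    rw [div_le_iff₀ h]; nlinarith [mul_nonneg ht (sq_nonneg (t - 1)), mul_nonneg ht (sq_nonneg t)]
  have h3 : t / (1 + t ^ 2) ≤ t := by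
    rw [div_le_iff₀ h]; nlinarith [mul_nonneg ht (sq_nonneg t)]
  have h4 : 0 ≤ t ^ 2 / (1 + t ^ 2) := by positivity
  have h5 : 0 ≤ t / (1 + t ^ 2) := by positivity
  fin_cases i <;> fin_cases j <;>
    simp only [lineProj, Fin.zero_eta, Fin.mk_one, Matrix.of_apply, Matrix.cons_val_zero,
      Matrix.cons_val_one, Matrix.cons_val_fin_one, Matrix.sub_apply, ← Complex.ofReal_sub,
      Complex.norm_real, Real.norm_eq_abs, ne_eq, OfNat.ofNat_ne_zero, not_false_eq_true,
      zero_pow, add_zero, div_one, sub_zero, h1, abs_neg, abs_of_nonneg h4,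
      abs_of_nonneg h5, h2, h3]

lemma specNorm_lineProj_sub_le {s t : ℝ} (hs : 0 ≤ s) (ht : 0 ≤ t) :
    specNorm (lineProj s - lineProj t) ≤ 4 * (s + t) := by
  have h := specNorm_sub_le (lineProj s - lineProj 0) (lineProj t - lineProj 0)
  rw [sub_sub_sub_cancel_right] at h
  linarith [specNorm_lineProj_sub_zero_le hs, specNorm_lineProj_sub_zero_le ht]

lemma le_specNorm_rankOnePert_mul (a b t : ℝ) :
    (a - 1) * (t / (1 + t ^ 2)) ≤
      specNorm (rankOnePert a (lineProj t) * rankOnePert b (lineProj 0)) := by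
  refine le_trans ?_ (norm_entry_le_specNorm _ 1 0)
  have : (rankOnePert a (lineProj t) * rankOnePert b (lineProj 0)) 1 0 =
      (((a - 1) * (t / (1 + t ^ 2)) : ℝ) : ℂ) := by
    simp [rankOnePert, lineProj, Matrix.mul_apply, Fin.sum_univ_two]
  rw [this, Complex.norm_real]
  exact le_abs_self _

lemma conjExp_pos {p : ℝ} (hp : 1 < p) : 0 < conjExp p :=
  div_pos (by linarith) (by linarith)

lemma lt_of_conjExp_lt {p q : ℝ} (hp : 1 < p) (hq : 1 < q) (h : conjExp p < conjExp q) :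
    q < p := by
  rw [conjExp, conjExp, div_lt_div_iff₀ (by linarith) (by linarith)] at h
  nlinarith

/-- The scalar weight `1 + |x - 1/3| ^ (-1/2)`. -/
def singWeight (x : ℝ) : ℝ := 1 + |x - 1 / 3| ^ (-(1 / 2) : ℝ)

lemma one_le_singWeight (x : ℝ) : 1 ≤ singWeight x :=
  le_add_of_nonneg_right (by positivity)

lemma singWeight_pos (x : ℝ) : 0 < singWeight x := zero_lt_one.trans_le (one_le_singWeight x)

@[fun_prop]
lemma measurable_singWeight : Measurable singWeight := by
  unfold singWeight
  fun_prop

lemma integrableOn_abs_sub_rpow (z : ℝ) {R : ℝ} (hR : 0 < R) :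
    IntegrableOn (fun x => |x - z| ^ (-(1 / 2) : ℝ)) (Set.Ioc (z - R) (z + R)) ∧
      ∫ x in Set.Ioc (z - R) (z + R), |x - z| ^ (-(1 / 2) : ℝ) = 4 * R ^ (1 / 2 : ℝ) := by
  have h0 : IntervalIntegrable (fun x : ℝ => |x| ^ (-(1 / 2) : ℝ)) volume 0 R := by
    refine (intervalIntegral.intervalIntegrable_rpow' (r := -(1 / 2)) (by norm_num)).congr ?_
    intro x hx
    rw [Set.uIoc_of_le hR.le] at hx
    simp [abs_of_pos hx.1]
  have i0 : ∫ x in (0 : ℝ)..R, |x| ^ (-(1 / 2) : ℝ) = 2 * R ^ (1 / 2 : ℝ) := by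
    rw [intervalIntegral.integral_congr (g := fun x => x ^ (-(1 / 2) : ℝ)),
      integral_rpow (by norm_num)]
    · norm_num
      ring
    · intro x hx
      rw [Set.uIcc_of_le hR.le] at hx
      simp [abs_of_nonneg hx.1]
  have h1 : IntervalIntegrable (fun x : ℝ => |x - z| ^ (-(1 / 2) : ℝ)) volume z (z + R) := by
    simpa [add_comm] using h0.comp_sub_right z
  have i1 : ∫ x in z..(z + R), |x - z| ^ (-(1 / 2) : ℝ) = 2 * R ^ (1 / 2 : ℝ) := by
    rw [intervalIntegral.integral_comp_sub_right (fun x => |x| ^ (-(1 / 2) : ℝ)) z]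
    simpa using i0
  have h2 : IntervalIntegrable (fun x : ℝ => |x - z| ^ (-(1 / 2) : ℝ)) volume (z - R) z := by
    have := (h0.comp_sub_left z).symm
    simp only [sub_zero] at this
    exact this.congr fun x _ => by simp [abs_sub_comm]
  have i2 : ∫ x in (z - R)..z, |x - z| ^ (-(1 / 2) : ℝ) = 2 * R ^ (1 / 2 : ℝ) := by
    simp_rw [abs_sub_comm _ z]
    rw [intervalIntegral.integral_comp_sub_left (fun x => |x| ^ (-(1 / 2) : ℝ)) z]
    simpa using i0
  have hle : z - R ≤ z + R := by linarith
  refine ⟨(intervalIntegrable_iff_integrableOn_Ioc_of_le hle).1 (h2.trans h1), ?_⟩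
  rw [← intervalIntegral.integral_of_le hle,
    ← intervalIntegral.integral_add_adjacent_intervals h2 h1, i1, i2]
  ring

lemma locallyIntegrable_singWeight : LocallyIntegrable singWeight volume := by
  refine (locallyIntegrable_const (1 : ℝ)).add ?_
  rw [locallyIntegrable_iff]
  intro K hK
  obtain ⟨R, hR, hKR⟩ := (hK.isBounded.subset_ball_lt 0 (1 / 3 : ℝ))
  refine (integrableOn_abs_sub_rpow (1 / 3) hR).1.mono_set (hKR.trans ?_)
  rw [Real.ball_eq_Ioo]
  exact Set.Ioo_subset_Ioc_self

lemma lavg_le_of_ae_le {α : Type*} [MeasurableSpace α] {μ : Measure α} {Q : Set α}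
    {f : α → ℝ≥0∞} {c : ℝ≥0∞} (h : ∀ᵐ x ∂μ, x ∈ Q → f x ≤ c) : lavg μ Q f ≤ c := by
  have h1 : ∫⁻ x in Q, f x ∂μ ≤ c * μ Q := by
    rw [← setLIntegral_const]
    exact setLIntegral_mono_ae aemeasurable_const h
  calc lavg μ Q f ≤ (μ Q)⁻¹ * (c * μ Q) := by unfold lavg; gcongr
    _ = c * ((μ Q)⁻¹ * μ Q) := by ring
    _ ≤ c * 1 := by gcongr; exact ENNReal.inv_mul_le_one _
    _ = c := mul_one c

lemma le_lavg_of_forall_le {α : Type*} [MeasurableSpace α] {μ : Measure α} {Q A : Set α}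
    (hA : MeasurableSet A) (hAQ : A ⊆ Q) {f : α → ℝ≥0∞} {c : ℝ≥0∞} (h : ∀ x ∈ A, c ≤ f x) :
    (μ Q)⁻¹ * μ A * c ≤ lavg μ Q f := by
  rw [mul_assoc]
  unfold lavg
  gcongr
  calc μ A * c = ∫⁻ _ in A, c ∂μ := by rw [setLIntegral_const, mul_comm]
    _ ≤ ∫⁻ x in A, f x ∂μ := setLIntegral_mono' hA h
    _ ≤ ∫⁻ x in Q, f x ∂μ := lintegral_mono_set hAQ

/-- The scalar weight `singWeight` is a Muckenhoupt `A₁` weight. -/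
lemma exists_lavg_singWeight_le {a b : ℝ} (hab : a < b) :
    ∃ m : ℝ, 0 < m ∧ (∀ y ∈ Set.Ico a b, y ≠ 1 / 3 → m ≤ singWeight y) ∧
      lavg volume (Set.Ico a b) (fun x => ENNReal.ofReal (singWeight x)) ≤
        ENNReal.ofReal (8 * m) := by
  set z : ℝ := 1 / 3 with hz
  set R : ℝ := max |a - z| |b - z| with hRdef
  have hQ (y : ℝ) (hy : y ∈ Set.Icc a b) : |y - z| ≤ R := by
    have := abs_le_max_abs_abs (sub_le_sub_right hy.1 z) (sub_le_sub_right hy.2 z)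
    exact this
  have hh : b - a ≤ 2 * R := by
    have h1 := abs_le.1 (hQ a ⟨le_rfl, hab.le⟩)
    have h2 := abs_le.1 (hQ b ⟨hab.le, le_rfl⟩)
    linarith
  have hR : 0 < R := by linarith
  have hRp : 0 < R ^ (-(1 / 2) : ℝ) := by positivity
  refine ⟨1 + R ^ (-(1 / 2) : ℝ), by positivity, ?_, ?_⟩
  · intro y hy hyz
    have : 0 < |y - z| := abs_pos.2 (sub_ne_zero.2 hyz)
    exact add_le_add_right
      (Real.rpow_le_rpow_of_nonpos this (hQ y ⟨hy.1, hy.2.le⟩) (by norm_num)) 1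
  · rcases le_or_gt (b - a) (R / 2) with hc | hc
    · refine lavg_le_of_ae_le (Filter.Eventually.of_forall fun x hx => ?_)
      refine ENNReal.ofReal_le_ofReal ?_
      have hx2 : R / 2 ≤ |x - z| := by
        have key : R ≤ |x - z| + (b - a) := by
          refine max_le ?_ ?_
          · have := abs_sub_le a x z
            have h3 : |a - x| ≤ b - a := by rw [abs_le]; constructor <;> linarith [hx.1, hx.2]
            linarith
          · have := abs_sub_le b x z
            have h3 : |b - x| ≤ b - a := by rw [abs_le]; constructor <;> linarith [hx.1, hx.2]
            linarith
        linarith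
      have h4 : |x - z| ^ (-(1 / 2) : ℝ) ≤ (R / 2) ^ (-(1 / 2) : ℝ) :=
        Real.rpow_le_rpow_of_nonpos (by positivity) hx2 (by norm_num)
      have h5 : (R / 2) ^ (-(1 / 2) : ℝ) ≤ 2 * R ^ (-(1 / 2) : ℝ) := by
        rw [Real.div_rpow hR.le zero_le_two, div_eq_mul_inv, mul_comm, ← Real.rpow_neg zero_le_two]
        gcongr
        calc (2 : ℝ) ^ (-(-(1 / 2)) : ℝ) ≤ 2 ^ (1 : ℝ) :=
              Real.rpow_le_rpow_of_exponent_le one_le_two (by norm_num)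
          _ = 2 := Real.rpow_one 2
      unfold singWeight
      linarith
    · obtain ⟨hi, hv⟩ := integrableOn_abs_sub_rpow z hR
      have h1 : ∫⁻ x in Set.Ico a b, ENNReal.ofReal (|x - z| ^ (-(1 / 2) : ℝ)) ≤
          ENNReal.ofReal (4 * R ^ (1 / 2 : ℝ)) := by
        rw [← hv, ofReal_integral_eq_lintegral_ofReal hi
          (Filter.Eventually.of_forall fun x => by positivity), setLIntegral_congr Ico_ae_eq_Ioc]
        refine lintegral_mono_set fun x hx => ?_
        have h1 := abs_le.1 (hQ a ⟨le_rfl, hab.le⟩)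
        have h2 := abs_le.1 (hQ b ⟨hab.le, le_rfl⟩)
        exact ⟨by linarith [hx.1], by linarith [hx.2]⟩
      have h2 : ∫⁻ x in Set.Ico a b, ENNReal.ofReal (singWeight x) ≤
          ENNReal.ofReal ((b - a) + 4 * R ^ (1 / 2 : ℝ)) := by
        have e (x : ℝ) : ENNReal.ofReal (singWeight x) =
            1 + ENNReal.ofReal (|x - z| ^ (-(1 / 2) : ℝ)) := by
          rw [singWeight, ENNReal.ofReal_add zero_le_one (by positivity), ENNReal.ofReal_one]
        simp_rw [e]
        rw [lintegral_add_left measurable_const, setLIntegral_const, Real.volume_Ico, one_mul,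
          ENNReal.ofReal_add (by linarith) (by positivity)]
        gcongr
      have hpos : 0 < b - a := sub_pos.2 hab
      have h3 : R ^ (1 / 2 : ℝ) = R * R ^ (-(1 / 2) : ℝ) := by
        rw [← Real.rpow_one_add' hR.le (by norm_num)]
        norm_num
      unfold lavg
      rw [Real.volume_Ico, ← ENNReal.ofReal_inv_of_pos hpos]
      calc _ ≤ ENNReal.ofReal (b - a)⁻¹ * ENNReal.ofReal ((b - a) + 4 * R ^ (1 / 2 : ℝ)) := by
            gcongr
        _ = ENNReal.ofReal ((b - a)⁻¹ * ((b - a) + 4 * R ^ (1 / 2 : ℝ))) := by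
            rw [ENNReal.ofReal_mul (by positivity)]
        _ ≤ _ := by
            refine ENNReal.ofReal_le_ofReal ?_
            rw [inv_mul_le_iff₀ hpos, h3]
            nlinarith [mul_lt_mul_of_pos_right hc hRp]

/-- The slope of the eigenline: it vanishes to the left of `1/3`, and to the right of `1/3` it
equals `w ^ (-σ) * log w` with `w = singWeight`. -/
def slope13 (σ x : ℝ) : ℝ :=
  if 1 / 3 < x then singWeight x ^ (-σ) * Real.log (singWeight x) else 0

lemma slope13_nonneg (σ x : ℝ) : 0 ≤ slope13 σ x := by
  have := Real.log_nonneg (one_le_singWeight x)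
  have := singWeight_pos x
  unfold slope13
  split_ifs <;> positivity

lemma measurable_slope13 (σ : ℝ) : Measurable (slope13 σ) := by
  unfold slope13
  refine Measurable.ite measurableSet_Ioi ?_ measurable_const
  fun_prop

lemma rpow_mul_slope13_le {s σ : ℝ} (h : s < σ) (x : ℝ) :
    singWeight x ^ s * slope13 σ x ≤ 1 / (σ - s) := by
  have hσ : 0 < σ - s := sub_pos.2 h
  have hx := singWeight_pos x
  unfold slope13
  split_ifs
  · have h1 := Real.log_le_rpow_div hx.le hσ
    calc singWeight x ^ s * (singWeight x ^ (-σ) * Real.log (singWeight x))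
        ≤ singWeight x ^ s * (singWeight x ^ (-σ) * (singWeight x ^ (σ - s) / (σ - s))) := by
          gcongr
      _ = (singWeight x ^ s * singWeight x ^ (-σ) * singWeight x ^ (σ - s)) / (σ - s) := by ring
      _ = 1 / (σ - s) := by
          rw [← Real.rpow_add hx, ← Real.rpow_add hx,
            show s + -σ + (σ - s) = 0 by ring, Real.rpow_zero]
  · simp only [mul_zero]
    positivity

/-- The `2 × 2` matrix weight with eigenvalues `singWeight` and `1`, where the eigenvalue
`singWeight` belongs to the line of slope `slope13 σ`. -/
def rotWeight (σ x : ℝ) : Matrix (Fin 2) (Fin 2) ℂ :=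
  rankOnePert (singWeight x) (lineProj (slope13 σ x))

lemma isMatrixWeight_rotWeight (σ : ℝ) : IsMatrixWeight (volume : Measure ℝ) (rotWeight σ) := by
  refine ⟨fun i j => ?_, Filter.Eventually.of_forall fun x =>
    posDef_rankOnePert (isSelfAdjoint_lineProj _) (isIdempotentElem_lineProj _)
      (one_le_singWeight x)⟩
  refine locallyIntegrable_singWeight.mono (Measurable.aestronglyMeasurable ?_)
    (Filter.Eventually.of_forall fun x => ?_)
  · have hτ := measurable_slope13 σ
    fin_cases i <;> fin_cases j <;>
      simp only [rotWeight, rankOnePert, lineProj, Fin.zero_eta, Fin.mk_one, Matrix.of_apply,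
        Matrix.cons_val_zero, Matrix.cons_val_one, Matrix.cons_val_fin_one, Matrix.add_apply,
        Matrix.smul_apply, Complex.real_smul] <;> fun_prop
  · have h1 : 1 ≤ singWeight x := one_le_singWeight x
    have hone : ‖(1 : Matrix (Fin 2) (Fin 2) ℂ) i j‖ ≤ 1 := by
      rw [Matrix.one_apply]; split_ifs <;> simp
    rw [Real.norm_of_nonneg (by linarith), rotWeight, rankOnePert, Matrix.add_apply,
      Matrix.smul_apply]
    refine (norm_add_le _ _).trans ?_
    rw [norm_smul, Real.norm_of_nonneg (by linarith)]
    have := mul_le_mul_of_nonneg_left (norm_lineProj_apply_le (slope13 σ x) i j)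
      (sub_nonneg.2 h1)
    linarith

lemma matRpow_rotWeight (σ x a : ℝ) :
    matRpow (rotWeight σ x) a = rankOnePert (singWeight x ^ a) (lineProj (slope13 σ x)) :=
  matRpow_rankOnePert (isSelfAdjoint_lineProj _) (isIdempotentElem_lineProj _) _ _

lemma specNorm_rotWeight_le {s σ : ℝ} (hs : 0 < s) (h : s < σ) (x y : ℝ) :
    specNorm (matRpow (rotWeight σ x) s * matRpow (rotWeight σ y) (-s)) ≤
      (45 + 20 * (1 / (σ - s))) * (1 + (singWeight x / singWeight y) ^ s) := by
  have hx := singWeight_pos x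
  have hy := singWeight_pos y
  rw [matRpow_rotWeight, matRpow_rotWeight, Real.rpow_neg hy.le, Real.div_rpow hx.le hy.le]
  have kx := rpow_mul_slope13_le h x
  have ky := rpow_mul_slope13_le h y
  have ha : 1 ≤ singWeight x ^ s := Real.one_le_rpow (one_le_singWeight x) hs.le
  have hb : 1 ≤ singWeight y ^ s := Real.one_le_rpow (one_le_singWeight y) hs.le
  refine (specNorm_rankOnePert_mul_le (isIdempotentElem_lineProj _) (specNorm_lineProj_le _)
    (specNorm_lineProj_le _) ha hb
    (specNorm_lineProj_sub_le (slope13_nonneg σ x) (slope13_nonneg σ y))).trans ?_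
  set a := singWeight x ^ s
  set b := singWeight y ^ s
  set K := 1 / (σ - s)
  have hab : 0 ≤ a / b := by positivity
  have e : a * slope13 σ y = (a / b) * (b * slope13 σ y) := by field_simp
  have := mul_le_mul_of_nonneg_left ky hab
  nlinarith

lemma matApq_rotWeight_lt_top {p q σ : ℝ} (hp : 1 < p) (hq : 0 < q) (h : 1 / q < σ) :
    matApq volume intervalsR (rotWeight σ) p q < ⊤ := by
  have hs : 0 < 1 / q := by positivity
  set C : ℝ := 45 + 20 * (1 / (σ - 1 / q)) with hC
  have hCpos : 0 < C := by
    have : 0 < σ - 1 / q := sub_pos.2 h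
    positivity
  refine lt_of_le_of_lt (b := ENNReal.ofReal ((2 * C) ^ q * 8)) ?_ ENNReal.ofReal_lt_top
  refine iSup₂_le fun Q hQ => ?_
  obtain ⟨a, b, hab, rfl⟩ := hQ
  obtain ⟨m, hm, hlow, hav⟩ := exists_lavg_singWeight_le hab
  have hp' := conjExp_pos hp
  have hinner : ∀ᵐ x ∂(volume : Measure ℝ), x ∈ Set.Ico a b →
      (lavg volume (Set.Ico a b) fun y =>
        ENNReal.ofReal (specNorm (matRpow (rotWeight σ x) (1 / q) *
          matRpow (rotWeight σ y) (-(1 / q)))) ^ conjExp p) ^ (q / conjExp p) ≤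
      ENNReal.ofReal ((2 * C) ^ q / m) * ENNReal.ofReal (singWeight x) := by
    filter_upwards [Measure.ae_ne volume (1 / 3 : ℝ)] with x hxz hx
    have hxm := hlow x hx hxz
    have hr : 1 ≤ singWeight x / m := (one_le_div hm).2 hxm
    have hr' : 1 ≤ (singWeight x / m) ^ (1 / q) := Real.one_le_rpow hr hs.le
    have hy : lavg volume (Set.Ico a b) (fun y =>
        ENNReal.ofReal (specNorm (matRpow (rotWeight σ x) (1 / q) *
          matRpow (rotWeight σ y) (-(1 / q)))) ^ conjExp p) ≤
        ENNReal.ofReal (2 * C * (singWeight x / m) ^ (1 / q)) ^ conjExp p := by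
      refine lavg_le_of_ae_le ?_
      filter_upwards [Measure.ae_ne volume (1 / 3 : ℝ)] with y hyz hy
      gcongr
      refine (specNorm_rotWeight_le hs h x y).trans ?_
      have hxpos := singWeight_pos x
      have : (singWeight x / singWeight y) ^ (1 / q) ≤ (singWeight x / m) ^ (1 / q) := by
        have := hlow y hy hyz
        have := singWeight_pos y
        gcongr
      nlinarith
    calc _ ≤ (ENNReal.ofReal (2 * C * (singWeight x / m) ^ (1 / q)) ^ conjExp p) ^
            (q / conjExp p) := by gcongr
      _ = ENNReal.ofReal ((2 * C) ^ q / m * singWeight x) := by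
          rw [← ENNReal.rpow_mul, mul_div_cancel₀ _ hp'.ne',
            ENNReal.ofReal_rpow_of_nonneg (by positivity) hq.le,
            Real.mul_rpow (by positivity) (by positivity), ← Real.rpow_mul (by positivity),
            one_div_mul_cancel hq.ne', Real.rpow_one]
          congr 1
          ring
      _ = _ := ENNReal.ofReal_mul (by positivity)
  calc _ ≤ (volume (Set.Ico a b))⁻¹ * ∫⁻ x in Set.Ico a b,
          ENNReal.ofReal ((2 * C) ^ q / m) * ENNReal.ofReal (singWeight x) := by
        refine mul_le_mul_right (setLIntegral_mono_ae ?_ hinner) _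
        exact (measurable_singWeight.ennreal_ofReal.const_mul _).aemeasurable
    _ = ENNReal.ofReal ((2 * C) ^ q / m) *
          lavg volume (Set.Ico a b) (fun x => ENNReal.ofReal (singWeight x)) := by
        rw [lintegral_const_mul' _ _ ENNReal.ofReal_ne_top, lavg]
        ring
    _ ≤ ENNReal.ofReal ((2 * C) ^ q / m) * ENNReal.ofReal (8 * m) := by gcongr
    _ = ENNReal.ofReal ((2 * C) ^ q * 8) := by
        rw [← ENNReal.ofReal_mul (by positivity)]
        congr 1
        field_simp

lemma le_specNorm_rotWeight {σ : ℝ} (hσ : 0 < σ) {x y : ℝ} (hx : 1 / 3 < x) (hy : y ≤ 1 / 3) :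
    (1 - singWeight x ^ (-σ)) * Real.log (singWeight x) / (1 + (1 / σ) ^ 2) ≤
      specNorm (matRpow (rotWeight σ x) σ * matRpow (rotWeight σ y) (-σ)) := by
  have hw := singWeight_pos x
  have hw1 := one_le_singWeight x
  have hlog := Real.log_nonneg hw1
  rw [matRpow_rotWeight, matRpow_rotWeight, show slope13 σ y = 0 from if_neg hy.not_gt]
  refine le_trans ?_ (le_specNorm_rankOnePert_mul _ _ _)
  have hτ0 := slope13_nonneg σ x
  have hτ : slope13 σ x ≤ 1 / σ := by simpa using rpow_mul_slope13_le hσ x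
  have e : (singWeight x ^ σ - 1) * slope13 σ x =
      (1 - singWeight x ^ (-σ)) * Real.log (singWeight x) := by
    rw [slope13, if_pos hx, ← mul_assoc, sub_mul, ← Real.rpow_add hw]
    simp
  rw [← mul_div_assoc, e]
  have : singWeight x ^ (-σ) ≤ 1 := Real.rpow_le_one_of_one_le_of_nonpos hw1 (by linarith)
  have h2 : 0 ≤ (1 - singWeight x ^ (-σ)) * Real.log (singWeight x) :=
    mul_nonneg (by linarith) hlog
  gcongr

lemma tendsto_one_sub_rpow_mul_log_div {σ : ℝ} (hσ : 0 < σ) :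
    Filter.Tendsto (fun w : ℝ => (1 - w ^ (-σ)) * Real.log w / (1 + (1 / σ) ^ 2))
      Filter.atTop Filter.atTop := by
  refine Filter.Tendsto.atTop_div_const (by positivity) ?_
  refine Filter.Tendsto.pos_mul_atTop (C := 1) one_pos ?_ Real.tendsto_log_atTop
  simpa using (tendsto_rpow_neg_atTop hσ).const_sub 1

/-- Arbitrarily short dyadic intervals contain `1/3` at relative position `1/3`. -/
lemma Ico_one_third_mem_dyadicsR (j : ℕ) :
    Set.Ico (1 / 3 - (4 ^ j : ℝ)⁻¹ / 3) (1 / 3 + 2 * (4 ^ j : ℝ)⁻¹ / 3) ∈ dyadicsR := by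
  have hd : (3 : ℤ) ∣ 4 ^ j - 1 := by
    simpa using sub_dvd_pow_sub_pow (4 : ℤ) 1 j
  obtain ⟨m, hm⟩ := hd
  have hm' : (4 : ℝ) ^ j - 1 = 3 * m := by exact_mod_cast hm
  have hm'' : (m : ℝ) = (4 ^ j - 1) / 3 := by linarith
  have h2 : (2 : ℝ) ^ (-(2 * (j : ℤ))) = (4 ^ j : ℝ)⁻¹ := by
    rw [zpow_neg, zpow_mul]
    norm_num
  refine ⟨m, -(2 * (j : ℤ)), ?_⟩
  have h4 : (4 : ℝ) ^ j ≠ 0 := by positivity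
  rw [h2, hm'']
  congr 1
  · field_simp
  · field_simp
    ring

lemma matApq_rotWeight_eq_top {p q : ℝ} (hp : 1 < p) (hq : 0 < q) :
    matApq volume dyadicsR (rotWeight (1 / q)) p q = ⊤ := by
  have hσ : 0 < 1 / q := by positivity
  have hp' := conjExp_pos hp
  set e := q / conjExp p with he
  have hepos : 0 < e := by positivity
  set t : ℝ≥0∞ := ENNReal.ofReal (1 / 3) with ht
  have ht0 : t ≠ 0 := by simp [ht]
  have htt : t ≠ ⊤ := ENNReal.ofReal_ne_top
  have key (M : ℝ) (hM : 0 ≤ M) : t * t ^ e * ENNReal.ofReal M ^ q ≤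
      matApq volume dyadicsR (rotWeight (1 / q)) p q := by
    obtain ⟨L, hL⟩ := Filter.eventually_atTop.1
      ((tendsto_one_sub_rpow_mul_log_div hσ).eventually_ge_atTop M)
    obtain ⟨j, hj⟩ := pow_unbounded_of_one_lt L (one_lt_two : (1 : ℝ) < 2)
    set h : ℝ := (4 ^ j : ℝ)⁻¹ with hh
    have hpos : 0 < h := by positivity
    have hdy := Ico_one_third_mem_dyadicsR j
    rw [← hh] at hdy
    set Q := Set.Ico (1 / 3 - h / 3) (1 / 3 + 2 * h / 3) with hQ
    have hvol (c d : ℝ) (hcd : d - c = h / 3) : (volume Q)⁻¹ * volume (Set.Ioo c d) = t := by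
      rw [hQ, Real.volume_Ico, Real.volume_Ioo, hcd,
        show 1 / 3 + 2 * h / 3 - (1 / 3 - h / 3) = h by ring, ← ENNReal.ofReal_inv_of_pos hpos,
        ← ENNReal.ofReal_mul (inv_nonneg.2 hpos.le), ht]
      congr 1
      field_simp
    have hw (x : ℝ) (hx : x ∈ Set.Ioo (1 / 3) (1 / 3 + h / 3)) : L ≤ singWeight x := by
      have h1 : |x - 1 / 3| ≤ h := by
        rw [abs_of_pos (sub_pos.2 hx.1)]
        linarith [hx.2]
      have h2 : h ^ (-(1 / 2) : ℝ) ≤ |x - 1 / 3| ^ (-(1 / 2) : ℝ) :=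
        Real.rpow_le_rpow_of_nonpos (abs_pos.2 (sub_ne_zero.2 hx.1.ne')) h1 (by norm_num)
      have h3 : h ^ (-(1 / 2) : ℝ) = 2 ^ j := by
        rw [hh, show (4 : ℝ) ^ j = (2 ^ j) ^ 2 by rw [← pow_mul, mul_comm, pow_mul]; norm_num,
          Real.rpow_neg (by positivity), ← Real.sqrt_eq_rpow, Real.sqrt_inv,
          Real.sqrt_sq (by positivity), inv_inv]
      unfold singWeight
      linarith
    have hin (x : ℝ) (hx : x ∈ Set.Ioo (1 / 3) (1 / 3 + h / 3)) :
        (t * ENNReal.ofReal M ^ conjExp p) ^ e ≤ (lavg volume Q fun y =>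
        ENNReal.ofReal (specNorm (matRpow (rotWeight (1 / q) x) (1 / q) *
          matRpow (rotWeight (1 / q) y) (-(1 / q)))) ^ conjExp p) ^ e := by
      gcongr
      rw [← hvol (1 / 3 - h / 3) (1 / 3) (by ring)]
      have hsub : Set.Ioo (1 / 3 - h / 3) (1 / 3) ⊆ Q := fun y hy =>
        ⟨hy.1.le, by linarith [hy.2]⟩
      refine le_lavg_of_forall_le measurableSet_Ioo hsub fun y hy => ?_
      gcongr
      exact (hL _ (hw x hx)).trans (le_specNorm_rotWeight hσ hx.1 hy.2.le)
    have hsub : Set.Ioo (1 / 3) (1 / 3 + h / 3) ⊆ Q := fun x hx =>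
      ⟨by linarith [hx.1], by linarith [hx.2]⟩
    have hout := le_lavg_of_forall_le (μ := volume) measurableSet_Ioo hsub hin
    rw [hvol _ _ (by ring), ENNReal.mul_rpow_of_nonneg _ _ hepos.le, ← ENNReal.rpow_mul, he,
      mul_div_cancel₀ _ hp'.ne', ← he, ← mul_assoc] at hout
    exact hout.trans (le_iSup₂_of_le Q hdy le_rfl)
  by_contra hne
  set S := matApq volume dyadicsR (rotWeight (1 / q)) p q with hS
  set c := t * t ^ e with hc
  have hc0 : c ≠ 0 := mul_ne_zero ht0 (ENNReal.rpow_pos (pos_iff_ne_zero.2 ht0) htt).ne'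
  have hct : c ≠ ⊤ := ENNReal.mul_ne_top htt (ENNReal.rpow_ne_top_of_nonneg hepos.le htt)
  have hfin : (S / c) ^ (1 / q) ≠ ⊤ :=
    ENNReal.rpow_ne_top_of_nonneg hσ.le (ENNReal.div_ne_top hne hc0)
  have h1 := key (((S / c) ^ (1 / q)).toReal + 1) (by positivity)
  rw [mul_comm, ← ENNReal.le_div_iff_mul_le (Or.inl hc0) (Or.inl hct)] at h1
  have h2 := ENNReal.rpow_le_rpow h1 hσ.le
  rw [← ENNReal.rpow_mul, mul_one_div_cancel hq.ne', ENNReal.rpow_one,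
    ENNReal.ofReal_le_iff_le_toReal hfin] at h2
  linarith

theorem statement6 (p₂ q₂ : ℝ) (hp₂ : 1 < p₂) (hpq₂ : p₂ ≤ q₂) :
    ∃ W : ℝ → Matrix (Fin 2) (Fin 2) ℂ,
      IsMatrixWeight (volume : Measure ℝ) W ∧
      matApq volume dyadicsR W p₂ q₂ = ⊤ ∧
      ∀ p₁ q₁ : ℝ, 1 < p₁ → p₁ ≤ q₁ →
        conjExp q₁ / p₁ = conjExp q₂ / p₂ → p₁ < p₂ →
        matApq volume intervalsR W p₁ q₁ < ⊤ := by
  have hq₂ : 1 < q₂ := hp₂.trans_le hpq₂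
  refine ⟨rotWeight (1 / q₂), isMatrixWeight_rotWeight _,
    matApq_rotWeight_eq_top hp₂ (by linarith), fun p₁ q₁ hp₁ hpq₁ hpq hlt => ?_⟩
  have hq₁ : 1 < q₁ := hp₁.trans_le hpq₁
  have hlt' : conjExp q₁ < conjExp q₂ := by
    have h2 := conjExp_pos hq₂
    rw [div_eq_div_iff (by linarith) (by linarith)] at hpq
    nlinarith
  have hq : q₂ < q₁ := lt_of_conjExp_lt hq₁ hq₂ hlt'
  exact matApq_rotWeight_lt_top hp₁ (by linarith) (one_div_lt_one_div_of_lt (by linarith) hq)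

end
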